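/- arXiv:1501.03395 — 9 statements merged into one kernel-verified Lean document; each statement's English description precedes it below -/
import Mathlib

section
/- Let n be a positive integer. The number of n²×n² S-permutation matrices is (n!)^{2n}. Formally, the set of functions A : (Fin n × Fin n) → (Fin n × Fin n) → Fin 2 (rows indexed by pairs (k,i) and columns by pairs (l,j)) such that every row of A contains exactly one entry equal to 1, every column of A contains exactly one entry equal to 1, and for every k, l the block {A (k,i) (l,j) : i, j ∈ Fin n} contains exactly one entry equal to 1, has cardinality (n!)^{2n}. -/
/-- An `n² × n²` binary matrix (entries in `Fin 2`), rows indexed by `(k,i)` and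
columns by `(l,j)`, is an S-permutation matrix if every row, every column, and
every block contains exactly one entry equal to `1`. -/
def IsSPerm (n : ℕ) (A : (Fin n × Fin n) → (Fin n × Fin n) → Fin 2) : Prop :=
  (∀ r : Fin n × Fin n, ∃! c : Fin n × Fin n, A r c = 1) ∧
  (∀ c : Fin n × Fin n, ∃! r : Fin n × Fin n, A r c = 1) ∧
  (∀ k l : Fin n, ∃! p : Fin n × Fin n, A (k, p.1) (l, p.2) = 1)

/-- The binary matrix whose `(k,l)`-th block has its only `1` at position `(σ k l, τ l k)`. -/
def blockMatrix {n : ℕ} (σ τ : Fin n → Equiv.Perm (Fin n)) :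
    (Fin n × Fin n) → (Fin n × Fin n) → Fin 2 :=
  fun r c => if σ r.1 c.1 = r.2 ∧ τ c.1 r.1 = c.2 then 1 else 0

theorem blockMatrix_eq_one_iff {n : ℕ} (σ τ : Fin n → Equiv.Perm (Fin n))
    (r c : Fin n × Fin n) :
    blockMatrix σ τ r c = 1 ↔ σ r.1 c.1 = r.2 ∧ τ c.1 r.1 = c.2 := by
  simp [blockMatrix]

theorem isSPerm_blockMatrix {n : ℕ} (σ τ : Fin n → Equiv.Perm (Fin n)) :
    IsSPerm n (blockMatrix σ τ) := by
  simp only [IsSPerm, blockMatrix_eq_one_iff]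
  refine ⟨fun ⟨k, i⟩ => ⟨((σ k).symm i, τ ((σ k).symm i) k), by simp, ?_⟩,
    fun ⟨l, j⟩ => ⟨((τ l).symm j, σ ((τ l).symm j) l), by simp, ?_⟩,
    fun k l => ⟨(σ k l, τ l k), by simp, ?_⟩⟩
  · rintro ⟨l, j⟩ ⟨h₁, h₂⟩
    dsimp only at h₁ h₂
    subst h₁ h₂
    simp
  · rintro ⟨k, i⟩ ⟨h₁, h₂⟩
    dsimp only at h₁ h₂
    subst h₁ h₂
    simp
  · rintro ⟨i, j⟩ ⟨rfl, rfl⟩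
    rfl

theorem IsSPerm.exists_blockMatrix_eq {n : ℕ}
    {A : (Fin n × Fin n) → (Fin n × Fin n) → Fin 2} (hA : IsSPerm n A) :
    ∃ σ τ : Fin n → Equiv.Perm (Fin n), blockMatrix σ τ = A := by
  obtain ⟨hrow, hcol, hblock⟩ := hA
  choose p hp hp_unique using hblock
  beta_reduce at hp hp_unique
  have hσ (k : Fin n) : Function.Injective fun l => (p k l).1 := by
    intro l l' h
    have h₁ := hp k l
    rw [show (p k l).1 = (p k l').1 from h] at h₁
    exact congrArg Prod.fst ((hrow _).unique h₁ (hp k l'))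
  have hτ (l : Fin n) : Function.Injective fun k => (p k l).2 := by
    intro k k' h
    have h₁ := hp k l
    rw [show (p k l).2 = (p k' l).2 from h] at h₁
    exact congrArg Prod.fst ((hcol _).unique h₁ (hp k' l))
  refine ⟨fun k => Equiv.ofBijective _ (Finite.injective_iff_bijective.mp (hσ k)),
    fun l => Equiv.ofBijective _ (Finite.injective_iff_bijective.mp (hτ l)), ?_⟩
  funext ⟨k, i⟩ ⟨l, j⟩
  have key : A (k, i) (l, j) = 1 ↔ (p k l).1 = i ∧ (p k l).2 = j := by
    constructor
    · intro h
      have := hp_unique k l (i, j) h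
      simp [← this]
    · rintro ⟨rfl, rfl⟩
      exact hp k l
  simp only [blockMatrix, Equiv.ofBijective_apply, ← key]
  split_ifs <;> omega

theorem blockMatrix_injective {n : ℕ} :
    Function.Injective fun x : (Fin n → Equiv.Perm (Fin n)) × (Fin n → Equiv.Perm (Fin n)) =>
      blockMatrix x.1 x.2 := by
  rintro ⟨σ, τ⟩ ⟨σ', τ'⟩ h
  have key (k l : Fin n) : σ' k l = σ k l ∧ τ' l k = τ l k := by
    have h₁ := (blockMatrix_eq_one_iff σ τ (k, σ k l) (l, τ l k)).mpr ⟨rfl, rfl⟩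
    rw [show blockMatrix σ τ = blockMatrix σ' τ' from h] at h₁
    exact (blockMatrix_eq_one_iff _ _ _ _).mp h₁
  refine Prod.ext ?_ ?_
  · funext k
    exact Equiv.ext fun l => (key k l).1.symm
  · funext l
    exact Equiv.ext fun k => (key k l).2.symm

theorem card_SPerm (n : ℕ) (hn : 0 < n) :
    Nat.card {A : (Fin n × Fin n) → (Fin n × Fin n) → Fin 2 // IsSPerm n A} =
      (Nat.factorial n) ^ (2 * n) := by
  let f (x : (Fin n → Equiv.Perm (Fin n)) × (Fin n → Equiv.Perm (Fin n))) :
      {A : (Fin n × Fin n) → (Fin n × Fin n) → Fin 2 // IsSPerm n A} :=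
    ⟨blockMatrix x.1 x.2, isSPerm_blockMatrix x.1 x.2⟩
  have hf : Function.Bijective f := by
    refine ⟨fun x y h => blockMatrix_injective (congrArg Subtype.val h), fun ⟨A, hA⟩ => ?_⟩
    obtain ⟨σ, τ, h⟩ := hA.exists_blockMatrix_eq
    exact ⟨(σ, τ), Subtype.ext h⟩
  rw [← Nat.card_eq_of_bijective f hf]
  simp [Fintype.card_perm, two_mul, pow_add]
end

section
/- Let n ≥ 2 be an integer, let A and B be n²×n² S-permutation matrices, and let Φ be the bijection sending an S-permutation matrix A to π ∈ Π_n with π k l the position of the unique 1 in block (k,l) of A. Then A and B are disjoint (i.e., there is no position where both A and B have entry 1) if and only if Φ(A) and Φ(B) are disjoint elements of Π_n (i.e., Φ(A) k l ≠ Φ(B) k l for all k, l). Consequently, the number of unordered disjoint pairs of n²×n² S-permutation matrices equals the number of unordered disjoint pairs of elements of Π_n. -/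
def IsPiMatrix (n : ℕ) (π : Fin n → Fin n → Fin n × Fin n) : Prop :=
  (∀ i : Fin n, Function.Bijective (fun j : Fin n => (π i j).1)) ∧
  (∀ j : Fin n, Function.Bijective (fun i : Fin n => (π i j).2))

/-- Two binary matrices are disjoint: there is no position where both are `1`. -/
def DisjointS (n : ℕ) (A B : (Fin n × Fin n) → (Fin n × Fin n) → Fin 2) : Prop :=
  ¬ ∃ r c : Fin n × Fin n, A r c = 1 ∧ B r c = 1

/-- Two `Π_n`-matrices are disjoint: they differ at every position. -/
def DisjointPi (n : ℕ) (π π' : Fin n → Fin n → Fin n × Fin n) : Prop :=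
  ∀ i j : Fin n, π i j ≠ π' i j

/-- The binary matrix whose block `(k, l)` has its only `1` at position `π k l`. -/
def binaryOfPi (n : ℕ) (π : Fin n → Fin n → Fin n × Fin n) :
    (Fin n × Fin n) → (Fin n × Fin n) → Fin 2 :=
  fun r c => if π r.1 c.1 = (r.2, c.2) then 1 else 0

theorem binaryOfPi_eq_one_iff {n : ℕ} {π : Fin n → Fin n → Fin n × Fin n}
    {r c : Fin n × Fin n} : binaryOfPi n π r c = 1 ↔ π r.1 c.1 = (r.2, c.2) := by
  simp [binaryOfPi]

theorem binaryOfPi_injective (n : ℕ) : Function.Injective (binaryOfPi n) := by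
  intro π π' h
  funext k l
  have h₁ : binaryOfPi n π (k, (π k l).1) (l, (π k l).2) = 1 := binaryOfPi_eq_one_iff.2 rfl
  rw [h, binaryOfPi_eq_one_iff] at h₁
  exact h₁.symm

theorem disjointS_binaryOfPi_iff {n : ℕ} {π π' : Fin n → Fin n → Fin n × Fin n} :
    DisjointS n (binaryOfPi n π) (binaryOfPi n π') ↔ DisjointPi n π π' := by
  simp only [DisjointS, DisjointPi, binaryOfPi_eq_one_iff]
  constructor
  · exact fun h i j hij => h ⟨(i, (π i j).1), (j, (π i j).2), rfl, hij.symm⟩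
  · rintro h ⟨r, c, h₁, h₂⟩
    exact h r.1 c.1 (h₁.trans h₂.symm)

theorem IsPiMatrix.isSPerm_binaryOfPi {n : ℕ} {π : Fin n → Fin n → Fin n × Fin n}
    (h : IsPiMatrix n π) : IsSPerm n (binaryOfPi n π) := by
  simp only [IsSPerm, binaryOfPi_eq_one_iff]
  refine ⟨?_, ?_, fun k l => ⟨π k l, rfl, fun p hp => hp.symm⟩⟩
  · rintro ⟨k, i⟩
    obtain ⟨l, hl, hu⟩ := (h.1 k).existsUnique i
    refine ⟨(l, (π k l).2), Prod.ext hl rfl, ?_⟩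
    rintro ⟨l', j⟩ hj
    obtain rfl := hu l' (congrArg Prod.fst hj)
    exact Prod.ext rfl (congrArg Prod.snd hj).symm
  · rintro ⟨l, j⟩
    obtain ⟨k, hk, hu⟩ := (h.2 l).existsUnique j
    refine ⟨(k, (π k l).1), Prod.ext rfl hk, ?_⟩
    rintro ⟨k', i⟩ hi
    obtain rfl := hu k' (congrArg Prod.snd hi)
    exact Prod.ext rfl (congrArg Prod.fst hi).symm

theorem IsSPerm.eq_binaryOfPi {n : ℕ} {A : (Fin n × Fin n) → (Fin n × Fin n) → Fin 2}
    (hA : IsSPerm n A) {π : Fin n → Fin n → Fin n × Fin n}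
    (hπ : ∀ k l, A (k, (π k l).1) (l, (π k l).2) = 1) : A = binaryOfPi n π := by
  funext r c
  have key : A r c = 1 ↔ binaryOfPi n π r c = 1 := by
    rw [binaryOfPi_eq_one_iff]
    constructor
    · exact fun h => (hA.2.2 r.1 c.1).unique (hπ r.1 c.1) (y₂ := (r.2, c.2)) h
    · intro h
      simpa [h] using hπ r.1 c.1
  omega

/-- Under the canonical bijection `Φ`, two S-permutation matrices are disjoint
iff their images in `Π_n` are disjoint; consequently the number of unordered
disjoint pairs of S-permutation matrices equals the number of unordered
disjoint pairs of elements of `Π_n`. -/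
theorem disjoint_iff_disjoint_pi (n : ℕ) (hn : 2 ≤ n)
    (Φ : {A : (Fin n × Fin n) → (Fin n × Fin n) → Fin 2 // IsSPerm n A} →
         {π : Fin n → Fin n → Fin n × Fin n // IsPiMatrix n π})
    (hΦ : ∀ A : {A : (Fin n × Fin n) → (Fin n × Fin n) → Fin 2 // IsSPerm n A},
      ∀ k l : Fin n, A.val (k, ((Φ A).val k l).1) (l, ((Φ A).val k l).2) = 1) :
    (∀ A B : {A : (Fin n × Fin n) → (Fin n × Fin n) → Fin 2 // IsSPerm n A},
      DisjointS n A.val B.val ↔ DisjointPi n (Φ A).val (Φ B).val) ∧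
    Nat.card {s : Set ((Fin n × Fin n) → (Fin n × Fin n) → Fin 2) //
        ∃ A B, IsSPerm n A ∧ IsSPerm n B ∧ DisjointS n A B ∧ s = {A, B}} =
      Nat.card {s : Set (Fin n → Fin n → Fin n × Fin n) //
        ∃ π π', IsPiMatrix n π ∧ IsPiMatrix n π' ∧ DisjointPi n π π' ∧ s = {π, π'}} := by
  have hA (A : {A // IsSPerm n A}) : A.val = binaryOfPi n (Φ A).val :=
    A.property.eq_binaryOfPi (hΦ A)
  refine ⟨fun A B => by rw [hA A, hA B, disjointS_binaryOfPi_iff], ?_⟩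
  refine Eq.trans ?_ (Nat.card_image_of_injective (binaryOfPi_injective n).image_injective
    {s : Set (Fin n → Fin n → Fin n × Fin n) |
      ∃ π π', IsPiMatrix n π ∧ IsPiMatrix n π' ∧ DisjointPi n π π' ∧ s = {π, π'}})
  refine Nat.card_congr (Equiv.subtypeEquivRight fun s => ?_)
  constructor
  · rintro ⟨A, B, hSA, hSB, hd, rfl⟩
    have eA := hA ⟨A, hSA⟩
    have eB := hA ⟨B, hSB⟩
    dsimp only at eA eB
    rw [eA, eB, disjointS_binaryOfPi_iff] at hd
    exact ⟨_, ⟨_, _, (Φ ⟨A, hSA⟩).property, (Φ ⟨B, hSB⟩).property, hd, rfl⟩,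
      by rw [Set.image_pair, ← eA, ← eB]⟩
  · rintro ⟨_, ⟨π, π', hπ, hπ', hd, rfl⟩, rfl⟩
    exact ⟨_, _, hπ.isSPerm_binaryOfPi, hπ'.isSPerm_binaryOfPi,
      disjointS_binaryOfPi_iff.2 hd, Set.image_pair ..⟩
end

section
/- Let n be a positive integer, let π ∈ Π_n, and let E ⊆ Fin n × Fin n be any set of positions. Then the number of matrices π' ∈ Π_n such that π' i j = π i j for every (i,j) ∈ E equals ∏_{i ∈ Fin n} (n − r_i)! · ∏_{j ∈ Fin n} (n − c_j)!, where r_i = |{j : (i,j) ∈ E}| is the number of positions of E in row i and c_j = |{i : (i,j) ∈ E}| is the number of positions of E in column j. -/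
/-- Bijective self-maps of a finite type that agree with a given bijection `f` on `s` are counted
by the permutations of the complement of `s`. -/
theorem card_bijective_agreeing {α : Type*} [Fintype α] [DecidableEq α] {f : α → α}
    (hf : Function.Bijective f) (s : Finset α) :
    Nat.card {g : α → α // Function.Bijective g ∧ ∀ a ∈ s, g a = f a} =
      Nat.factorial (Fintype.card α - s.card) := by
  let F : Equiv.Perm α := Equiv.ofBijective f hf
  let e : {σ : Equiv.Perm α // ∀ a, ¬ a ∉ s → σ a = a} ≃
      {g : α → α // Function.Bijective g ∧ ∀ a ∈ s, g a = f a} :=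
    { toFun σ := ⟨F * σ.1, (F * σ.1).bijective, fun a ha =>
        congrArg f (σ.2 a (not_not.mpr ha))⟩
      invFun g := ⟨F⁻¹ * Equiv.ofBijective g.1 g.2.1, fun a ha =>
        F.symm_apply_eq.mpr (g.2.2 a (not_not.mp ha))⟩
      left_inv σ := Subtype.ext <| Equiv.ext fun a => F.symm_apply_apply (σ.1 a)
      right_inv g := Subtype.ext <| funext fun a => F.apply_symm_apply (g.1 a) }
  rw [← Nat.card_congr e, ← Nat.card_congr (Equiv.Perm.subtypeEquivSubtypePerm (· ∉ s)),
    Nat.card_perm, Nat.card_eq_fintype_card, Fintype.card_subtype_compl, Fintype.card_coe]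

/-- A matrix in `Π_n` agreeing with `π` on `E` amounts to independent choices, one for each row's
first coordinates and one for each column's second coordinates. -/
def agreeingPiMatrixEquiv (n : ℕ) (π : Fin n → Fin n → Fin n × Fin n)
    (E : Finset (Fin n × Fin n)) :
    {π' : Fin n → Fin n → Fin n × Fin n //
        IsPiMatrix n π' ∧ ∀ p ∈ E, π' p.1 p.2 = π p.1 p.2} ≃
      ((i : Fin n) → {g : Fin n → Fin n // Function.Bijective g ∧
        ∀ j ∈ (E.filter (fun p => p.1 = i)).image Prod.snd, g j = (π i j).1}) ×
      ((j : Fin n) → {g : Fin n → Fin n // Function.Bijective g ∧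
        ∀ i ∈ (E.filter (fun p => p.2 = j)).image Prod.fst, g i = (π i j).2}) where
  toFun π' :=
    (fun i => ⟨fun j => (π'.1 i j).1, π'.2.1.1 i, fun j hj => by
        have hE : (i, j) ∈ E := by simpa using hj
        exact congrArg Prod.fst (π'.2.2 _ hE)⟩,
      fun j => ⟨fun i => (π'.1 i j).2, π'.2.1.2 j, fun i hi => by
        have hE : (i, j) ∈ E := by simpa using hi
        exact congrArg Prod.snd (π'.2.2 _ hE)⟩)
  invFun g :=
    ⟨fun i j => ((g.1 i).1 j, (g.2 j).1 i),
      ⟨fun i => (g.1 i).2.1, fun j => (g.2 j).2.1⟩, fun p hp =>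
      Prod.ext ((g.1 p.1).2.2 p.2 (by simpa using hp)) ((g.2 p.2).2.2 p.1 (by simpa using hp))⟩
  left_inv _ := rfl
  right_inv _ := rfl

/-- The number of `π' ∈ Π_n` agreeing with `π` on all positions of a given set
`E` equals `∏ᵢ (n - rᵢ)! · ∏ⱼ (n - cⱼ)!`, where `rᵢ` (resp. `cⱼ`) is the number
of positions of `E` in row `i` (resp. column `j`). -/
theorem card_agreeing_piMatrix (n : ℕ) (hn : 0 < n)
    (π : Fin n → Fin n → Fin n × Fin n) (hπ : IsPiMatrix n π)
    (E : Finset (Fin n × Fin n)) :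
    Nat.card {π' : Fin n → Fin n → Fin n × Fin n //
        IsPiMatrix n π' ∧ ∀ p ∈ E, π' p.1 p.2 = π p.1 p.2} =
      (∏ i : Fin n, Nat.factorial (n - (E.filter (fun p => p.1 = i)).card)) *
      (∏ j : Fin n, Nat.factorial (n - (E.filter (fun p => p.2 = j)).card)) := by
  rw [Nat.card_congr (agreeingPiMatrixEquiv n π E), Nat.card_prod, Nat.card_pi, Nat.card_pi]
  congr 1 <;> refine Finset.prod_congr rfl fun k _ => ?_
  · rw [card_bijective_agreeing (hπ.1 k), Fintype.card_fin, Finset.card_image_of_injOn]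
    intro p hp q hq h
    simp only [Finset.coe_filter, Set.mem_ofPred_eq] at hp hq
    exact Prod.ext (hp.2.trans hq.2.symm) h
  · rw [card_bijective_agreeing (hπ.2 k), Fintype.card_fin, Finset.card_image_of_injOn]
    intro p hp q hq h
    simp only [Finset.coe_filter, Set.mem_ofPred_eq] at hp hq
    exact Prod.ext h (hp.2.trans hq.2.symm)
end

section
/- Let n ≥ 2 be an integer and let π ∈ Π_n. Then the number ξ_n of matrices π' ∈ Π_n that are disjoint from π (i.e., π' i j ≠ π i j for all i,j) equals Σ_{E ⊆ Fin n × Fin n} (−1)^{|E|} · ∏_{i ∈ Fin n} (n − r_i(E))! · ∏_{j ∈ Fin n} (n − c_j(E))!, where r_i(E) = |{j : (i,j) ∈ E}| and c_j(E) = |{i : (i,j) ∈ E}|. In particular this number does not depend on the choice of π. -/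
/-- The number of self-bijections of a finite type that agree with a given one on a set `s`. -/
theorem card_bijective_eqOn {α : Type*} [Fintype α] [DecidableEq α] (s : Finset α)
    {g : α → α} (hg : Function.Bijective g) :
    Nat.card {f : α → α // Function.Bijective f ∧ ∀ a ∈ s, f a = g a} =
      (Fintype.card α - s.card).factorial := by
  let τ := Equiv.ofBijective g hg
  let e : {f : α → α // Function.Bijective f ∧ ∀ a ∈ s, f a = g a} ≃
      {σ : Equiv.Perm α // ∀ a, ¬ (a ∉ s) → σ a = a} :=
    { toFun f := ⟨(Equiv.ofBijective f.1 f.2.1).trans τ.symm, fun a ha => by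
        simp [f.2.2 a (not_not.1 ha), τ]⟩
      invFun σ := ⟨σ.1.trans τ, (σ.1.trans τ).bijective, fun a ha => by
        simp [σ.2 a (not_not.2 ha), τ]⟩
      left_inv f := by ext a; simp
      right_inv σ := by ext a; simp }
  rw [Nat.card_congr (e.trans (Equiv.Perm.subtypeEquivSubtypePerm (· ∉ s)).symm),
    Nat.card_perm, Nat.card_eq_fintype_card, Fintype.card_subtype_compl]
  simp

/-- The number of `Π_n`-matrices that agree with a given one on a set `E` of positions. -/
theorem card_piMatrix_eqOn {n : ℕ} {π : Fin n → Fin n → Fin n × Fin n} (hπ : IsPiMatrix n π)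
    (E : Finset (Fin n × Fin n)) :
    Nat.card {π' : {π' // IsPiMatrix n π'} // ∀ p ∈ E, π'.1 p.1 p.2 = π p.1 p.2} =
      (∏ i : Fin n, (n - (E.filter (fun p => p.1 = i)).card).factorial) *
        ∏ j : Fin n, (n - (E.filter (fun p => p.2 = j)).card).factorial := by
  let row (i : Fin n) : Finset (Fin n) := {j | (i, j) ∈ E}
  let col (j : Fin n) : Finset (Fin n) := {i | (i, j) ∈ E}
  have hrow (i : Fin n) : (row i).card = (E.filter (fun p => p.1 = i)).card :=
    Finset.card_bij (fun j _ => (i, j)) (by simp [row]) (by simp) (by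
      rintro ⟨a, b⟩ h
      obtain ⟨h, rfl⟩ := Finset.mem_filter.1 h
      exact ⟨b, by simpa [row] using h, rfl⟩)
  have hcol (j : Fin n) : (col j).card = (E.filter (fun p => p.2 = j)).card :=
    Finset.card_bij (fun i _ => (i, j)) (by simp [col]) (by simp) (by
      rintro ⟨a, b⟩ h
      obtain ⟨h, rfl⟩ := Finset.mem_filter.1 h
      exact ⟨a, by simpa [col] using h, rfl⟩)
  let e : {π' : {π' // IsPiMatrix n π'} // ∀ p ∈ E, π'.1 p.1 p.2 = π p.1 p.2} ≃
      (∀ i, {f : Fin n → Fin n // Function.Bijective f ∧ ∀ j ∈ row i, f j = (π i j).1}) ×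
      (∀ j, {f : Fin n → Fin n // Function.Bijective f ∧ ∀ i ∈ col j, f i = (π i j).2}) :=
    { toFun π' :=
        (fun i => ⟨fun j => (π'.1.1 i j).1, π'.1.2.1 i, fun j hj =>
          congrArg (·.1) (π'.2 (i, j) (by simpa [row] using hj))⟩,
         fun j => ⟨fun i => (π'.1.1 i j).2, π'.1.2.2 j, fun i hi =>
          congrArg (·.2) (π'.2 (i, j) (by simpa [col] using hi))⟩)
      invFun x := ⟨⟨fun i j => ((x.1 i).1 j, (x.2 j).1 i),
          fun i => (x.1 i).2.1, fun j => (x.2 j).2.1⟩, fun p hp =>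
        Prod.ext ((x.1 p.1).2.2 p.2 (by simpa [row] using hp))
          ((x.2 p.2).2.2 p.1 (by simpa [col] using hp))⟩
      left_inv _ := rfl
      right_inv _ := rfl }
  rw [Nat.card_congr e, Nat.card_prod, Nat.card_pi, Nat.card_pi]
  congr 1 <;> refine Finset.prod_congr rfl fun k _ => ?_
  · rw [card_bijective_eqOn (row k) (hπ.1 k), hrow, Fintype.card_fin]
  · rw [card_bijective_eqOn (col k) (hπ.2 k), hcol, Fintype.card_fin]

/-- Inclusion–exclusion formula for the number `ξ_n` of `Π_n`-matrices disjoint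
from a fixed `π ∈ Π_n`; in particular it does not depend on `π`. -/
theorem card_disjoint_piMatrix (n : ℕ) (hn : 2 ≤ n)
    (π : Fin n → Fin n → Fin n × Fin n) (hπ : IsPiMatrix n π) :
    (Nat.card {π' : Fin n → Fin n → Fin n × Fin n //
        IsPiMatrix n π' ∧ ∀ i j : Fin n, π' i j ≠ π i j} : ℤ) =
      ∑ E : Finset (Fin n × Fin n), (-1 : ℤ) ^ E.card *
        ((∏ i : Fin n, (Nat.factorial (n - (E.filter (fun p => p.1 = i)).card) : ℤ)) *
         (∏ j : Fin n, (Nat.factorial (n - (E.filter (fun p => p.2 = j)).card) : ℤ))) := by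
  classical
  let S (p : Fin n × Fin n) : Finset {π' // IsPiMatrix n π'} := {π' | π'.1 p.1 p.2 = π p.1 p.2}
  have hdisj : Nat.card {π' : Fin n → Fin n → Fin n × Fin n //
      IsPiMatrix n π' ∧ ∀ i j : Fin n, π' i j ≠ π i j} =
        (Finset.univ.inf fun p => (S p)ᶜ).card := by
    rw [← Nat.card_congr (Equiv.subtypeSubtypeEquivSubtypeInter (IsPiMatrix n)
      fun π' => ∀ i j, π' i j ≠ π i j)]
    refine Nat.subtype_card _ fun π' => ?_
    simp [Finset.mem_inf, S, Prod.forall]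
  have hagree (E : Finset (Fin n × Fin n)) : (E.inf S).card =
      Nat.card {π' : {π' // IsPiMatrix n π'} // ∀ p ∈ E, π'.1 p.1 p.2 = π p.1 p.2} :=
    (Nat.subtype_card _ fun π' => by simp [Finset.mem_inf, S]).symm
  rw [hdisj, Finset.inclusion_exclusion_card_inf_compl, Finset.powerset_univ]
  refine Finset.sum_congr rfl fun E _ => ?_
  rw [hagree, card_piMatrix_eqOn hπ]
  push_cast
  rfl
end

section
/- Let n ≥ 2 be an integer and let A be an n²×n² S-permutation matrix. Then the number of n²×n² S-permutation matrices B that are disjoint from A equals Σ_{E ⊆ Fin n × Fin n} (−1)^{|E|} · ∏_{i ∈ Fin n} (n − r_i(E))! · ∏_{j ∈ Fin n} (n − c_j(E))!, where r_i(E) = |{j : (i,j) ∈ E}| and c_j(E) = |{i : (i,j) ∈ E}|. In particular this number is the same for every A. -/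
/-- The pairs `(σ, τ)` of families of permutations that parametrize S-permutation matrices: the
block `(k, l)` has its `1` in row `σ k l` and column `τ l k`. -/
abbrev PermFamilies (n : ℕ) : Type :=
  (Fin n → Equiv.Perm (Fin n)) × (Fin n → Equiv.Perm (Fin n))

/-- The binary matrix whose block `(k, l)` has its only `1` at position `(x.1 k l, x.2 l k)`. -/
def PermFamilies.toMatrix {n : ℕ} (x : PermFamilies n) :
    (Fin n × Fin n) → (Fin n × Fin n) → Fin 2 :=
  fun r c => if r.2 = x.1 r.1 c.1 ∧ c.2 = x.2 c.1 r.1 then 1 else 0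

lemma PermFamilies.toMatrix_eq_one_iff {n : ℕ} (x : PermFamilies n) (r c : Fin n × Fin n) :
    x.toMatrix r c = 1 ↔ r.2 = x.1 r.1 c.1 ∧ c.2 = x.2 c.1 r.1 := by
  simp [PermFamilies.toMatrix]

lemma PermFamilies.isSPerm_toMatrix {n : ℕ} (x : PermFamilies n) : IsSPerm n x.toMatrix := by
  simp only [IsSPerm, PermFamilies.toMatrix_eq_one_iff]
  refine ⟨fun ⟨k, p⟩ => ⟨((x.1 k).symm p, x.2 ((x.1 k).symm p) k), by simp, ?_⟩,
    fun ⟨l, q⟩ => ⟨((x.2 l).symm q, x.1 ((x.2 l).symm q) l), by simp, ?_⟩,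
    fun k l => ⟨(x.1 k l, x.2 l k), by simp, ?_⟩⟩
  · rintro ⟨l, q⟩ ⟨h₁, h₂⟩
    dsimp only at h₁ h₂
    subst h₁ h₂
    simp
  · rintro ⟨k, p⟩ ⟨h₁, h₂⟩
    dsimp only at h₁ h₂
    subst h₁ h₂
    simp
  · rintro ⟨p, q⟩ ⟨h₁, h₂⟩
    exact Prod.ext h₁ h₂

lemma PermFamilies.toMatrix_injective {n : ℕ} :
    Function.Injective (PermFamilies.toMatrix (n := n)) := by
  intro x y h
  have key (k l : Fin n) : x.1 k l = y.1 k l ∧ x.2 l k = y.2 l k := by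
    have hx : x.toMatrix (k, x.1 k l) (l, x.2 l k) = 1 := by
      simp [PermFamilies.toMatrix_eq_one_iff]
    rw [h, PermFamilies.toMatrix_eq_one_iff] at hx
    exact hx
  refine Prod.ext ?_ ?_
  · funext k
    exact Equiv.ext fun l => (key k l).1
  · funext l
    exact Equiv.ext fun k => (key k l).2

lemma IsSPerm.exists_toMatrix_eq {n : ℕ} {B : (Fin n × Fin n) → (Fin n × Fin n) → Fin 2}
    (hB : IsSPerm n B) : ∃ x : PermFamilies n, x.toMatrix = B := by
  obtain ⟨hrow, hcol, hblock⟩ := hB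
  choose P hP hPu using hblock
  dsimp only at hP hPu
  have hσ (k : Fin n) : Function.Injective fun l => (P k l).1 := by
    intro l l' h
    dsimp only at h
    have h' := hP k l'
    rw [← h] at h'
    exact congrArg Prod.fst ((hrow _).unique (hP k l) h')
  have hτ (l : Fin n) : Function.Injective fun k => (P k l).2 := by
    intro k k' h
    dsimp only at h
    have h' := hP k' l
    rw [← h] at h'
    exact congrArg Prod.fst ((hcol _).unique (hP k l) h')
  refine ⟨(fun k => Equiv.ofBijective _ (Finite.injective_iff_bijective.mp (hσ k)),
    fun l => Equiv.ofBijective _ (Finite.injective_iff_bijective.mp (hτ l))), ?_⟩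
  funext ⟨k, p⟩ ⟨l, q⟩
  have hiff : B (k, p) (l, q) = 1 ↔ p = (P k l).1 ∧ q = (P k l).2 := by
    constructor
    · intro h
      have := hPu k l (p, q) h
      exact ⟨congrArg Prod.fst this, congrArg Prod.snd this⟩
    · rintro ⟨rfl, rfl⟩
      exact hP k l
  simp only [PermFamilies.toMatrix, Equiv.ofBijective_apply]
  split_ifs with h
  · exact (hiff.mpr h).symm
  · have := mt hiff.mp h
    lia

lemma disjointS_toMatrix_iff {n : ℕ} (x y : PermFamilies n) :
    DisjointS n x.toMatrix y.toMatrix ↔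
      ∀ e : Fin n × Fin n, ¬ (y.1 e.1 e.2 = x.1 e.1 e.2 ∧ y.2 e.2 e.1 = x.2 e.2 e.1) := by
  simp only [DisjointS, PermFamilies.toMatrix_eq_one_iff]
  constructor
  · rintro h ⟨k, l⟩ ⟨h₁, h₂⟩
    exact h ⟨(k, x.1 k l), (l, x.2 l k), ⟨rfl, rfl⟩, h₁.symm, h₂.symm⟩
  · rintro h ⟨⟨k, p⟩, ⟨l, q⟩, ⟨h₁, h₂⟩, h₃, h₄⟩
    exact h (k, l) ⟨h₃.symm.trans h₁, h₄.symm.trans h₂⟩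

lemma card_perm_eqOn {α : Type*} [Fintype α] [DecidableEq α] (σ : Equiv.Perm α) (S : Finset α) :
    Nat.card {f : Equiv.Perm α // ∀ a ∈ S, f a = σ a} =
      (Fintype.card α - S.card).factorial := by
  have e₁ : {f : Equiv.Perm α // ∀ a ∈ S, f a = σ a} ≃
      {f : Equiv.Perm α // ∀ a, ¬ a ∉ S → f a = a} :=
    (Equiv.mulLeft σ⁻¹).subtypeEquiv fun f => by
      simp [Equiv.symm_apply_eq]
  rw [Nat.card_congr (e₁.trans (Equiv.Perm.subtypeEquivSubtypePerm (· ∉ S)).symm),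
    Nat.card_perm]
  simp

lemma card_permFamily_eqOn {ι α : Type*} [Fintype ι] [DecidableEq ι] [Fintype α] [DecidableEq α]
    (σ : ι → Equiv.Perm α) (S : ι → Finset α) :
    Nat.card {f : ι → Equiv.Perm α // ∀ i, ∀ a ∈ S i, f i a = σ i a} =
      ∏ i, (Fintype.card α - (S i).card).factorial := by
  rw [Nat.card_congr (Equiv.subtypePiEquivPi (p := fun i (f : Equiv.Perm α) =>
    ∀ a ∈ S i, f a = σ i a)), Nat.card_pi]
  simp only [card_perm_eqOn]

lemma card_permFamilies_agree {n : ℕ} (x : PermFamilies n) (E : Finset (Fin n × Fin n)) :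
    Nat.card {y : PermFamilies n //
        ∀ e ∈ E, y.1 e.1 e.2 = x.1 e.1 e.2 ∧ y.2 e.2 e.1 = x.2 e.2 e.1} =
      (∏ i : Fin n, (n - (E.filter (fun p => p.1 = i)).card).factorial) *
        ∏ j : Fin n, (n - (E.filter (fun p => p.2 = j)).card).factorial := by
  have hr (i : Fin n) : (E.filter (fun p => p.1 = i)).card =
      (Finset.univ.filter fun j => (i, j) ∈ E).card := by
    refine Finset.card_nbij' Prod.snd (fun j => (i, j)) ?_ ?_ ?_ ?_ <;>
      simp +contextual [Set.MapsTo, Set.LeftInvOn]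
    rintro a b h rfl
    exact h
  have hc (j : Fin n) : (E.filter (fun p => p.2 = j)).card =
      (Finset.univ.filter fun i => (i, j) ∈ E).card := by
    refine Finset.card_nbij' Prod.fst (fun i => (i, j)) ?_ ?_ ?_ ?_ <;>
      simp +contextual [Set.MapsTo, Set.LeftInvOn]
    rintro a b h rfl
    exact h
  have h₁ := card_permFamily_eqOn x.1 fun i => Finset.univ.filter fun j => (i, j) ∈ E
  have h₂ := card_permFamily_eqOn x.2 fun j => Finset.univ.filter fun i => (i, j) ∈ E
  simp only [Fintype.card_fin] at h₁ h₂
  simp only [hr, hc]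
  rw [← h₁, ← h₂, ← Nat.card_prod]
  refine Nat.card_congr ((Equiv.subtypeEquivRight fun y => ?_).trans
    Equiv.subtypeProdEquivProd)
  simp only [Finset.mem_filter, Finset.mem_univ, true_and]
  exact ⟨fun h => ⟨fun i j hij => (h _ hij).1, fun j i hij => (h _ hij).2⟩,
    fun h e he => ⟨h.1 e.1 e.2 he, h.2 e.2 e.1 he⟩⟩


/-- Inclusion–exclusion formula for the number of S-permutation matrices
disjoint from a fixed S-permutation matrix `A`; in particular this number is
the same for every `A`. -/
theorem card_disjoint_sperm (n : ℕ) (hn : 2 ≤ n)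
    (A : (Fin n × Fin n) → (Fin n × Fin n) → Fin 2) (hA : IsSPerm n A) :
    (Nat.card {B : (Fin n × Fin n) → (Fin n × Fin n) → Fin 2 //
        IsSPerm n B ∧ DisjointS n A B} : ℤ) =
      ∑ E : Finset (Fin n × Fin n), (-1 : ℤ) ^ E.card *
        ((∏ i : Fin n, (Nat.factorial (n - (E.filter (fun p => p.1 = i)).card) : ℤ)) *
         (∏ j : Fin n, (Nat.factorial (n - (E.filter (fun p => p.2 = j)).card) : ℤ))) := by
  obtain ⟨x, rfl⟩ := hA.exists_toMatrix_eq
  let S (e : Fin n × Fin n) : Finset (PermFamilies n) :=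
    Finset.univ.filter fun y => y.1 e.1 e.2 = x.1 e.1 e.2 ∧ y.2 e.2 e.1 = x.2 e.2 e.1
  have hcard : Nat.card {B : (Fin n × Fin n) → (Fin n × Fin n) → Fin 2 //
      IsSPerm n B ∧ DisjointS n x.toMatrix B} =
      (Finset.univ.inf fun e => (S e)ᶜ).card := by
    rw [← Nat.card_eq_finsetCard]
    have hmem (y : PermFamilies n) :
        y ∈ (Finset.univ.inf fun e => (S e)ᶜ) ↔ DisjointS n x.toMatrix y.toMatrix := by
      rw [disjointS_toMatrix_iff, Finset.mem_inf]
      simp [S]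
    refine (Nat.card_congr (Equiv.ofBijective (fun y => ⟨y.1.toMatrix, y.1.isSPerm_toMatrix,
      (hmem y.1).mp y.2⟩) ⟨?_, ?_⟩)).symm
    · intro y z h
      exact Subtype.ext (PermFamilies.toMatrix_injective (congrArg Subtype.val h))
    · rintro ⟨B, hB, hd⟩
      obtain ⟨y, rfl⟩ := hB.exists_toMatrix_eq
      exact ⟨⟨y, (hmem y).mpr hd⟩, rfl⟩
  rw [hcard, Finset.inclusion_exclusion_card_inf_compl, Finset.powerset_univ]
  refine Finset.sum_congr rfl fun E _ => ?_
  have hE := card_permFamilies_agree x E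
  rw [Nat.card_eq_fintype_card, Fintype.card_subtype] at hE
  have hS : E.inf S = Finset.univ.filter fun y : PermFamilies n =>
      ∀ e ∈ E, y.1 e.1 e.2 = x.1 e.1 e.2 ∧ y.2 e.2 e.1 = x.2 e.2 e.1 := by
    ext y
    simp [S, Finset.mem_inf]
  rw [hS, hE]
  push_cast
  rfl
end

section
/- For every 4×4 S-permutation matrix A (the case n = 2), the number of 4×4 S-permutation matrices B disjoint from A is exactly 7. -/
/-- The `4 × 4` matrix whose `(k, l)`-th block has its only `1` at position `(a k + l, b l + k)`. -/
def spermOfShifts (s : (Fin 2 → Fin 2) × (Fin 2 → Fin 2)) :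
    (Fin 2 × Fin 2) → (Fin 2 × Fin 2) → Fin 2 :=
  fun r c => if r.2 = s.1 r.1 + c.1 ∧ c.2 = s.2 c.1 + r.1 then 1 else 0

theorem spermOfShifts_eq_one_iff (s : (Fin 2 → Fin 2) × (Fin 2 → Fin 2)) (k i l j : Fin 2) :
    spermOfShifts s (k, i) (l, j) = 1 ↔ i = s.1 k + l ∧ j = s.2 l + k := by
  simp [spermOfShifts]

theorem fin_two_eq_of_eq_one_iff {x y : Fin 2} (h : x = 1 ↔ y = 1) : x = y := by
  revert x y; decide

theorem fin_two_eq_add_one_of_ne {x y : Fin 2} (h : x ≠ y) : y = x + 1 := by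
  revert x y; decide

theorem fin_two_eq_add_iff (x y z : Fin 2) : x = y + z ↔ z = x + y := by
  revert x y z; decide

theorem isSPerm_spermOfShifts (s : (Fin 2 → Fin 2) × (Fin 2 → Fin 2)) :
    IsSPerm 2 (spermOfShifts s) := by
  refine ⟨?_, ?_, ?_⟩
  · rintro ⟨k, i⟩
    refine ⟨(i + s.1 k, s.2 (i + s.1 k) + k), ?_, ?_⟩
    · simp only [spermOfShifts_eq_one_iff, fin_two_eq_add_iff i, and_self]
    · rintro ⟨l, j⟩ h
      obtain ⟨hi, hj⟩ := (spermOfShifts_eq_one_iff s k i l j).1 h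
      rw [fin_two_eq_add_iff] at hi
      subst hi
      rw [hj]
  · rintro ⟨l, j⟩
    refine ⟨(j + s.2 l, s.1 (j + s.2 l) + l), ?_, ?_⟩
    · simp only [spermOfShifts_eq_one_iff, fin_two_eq_add_iff j, and_self]
    · rintro ⟨k, i⟩ h
      obtain ⟨hi, hj⟩ := (spermOfShifts_eq_one_iff s k i l j).1 h
      rw [fin_two_eq_add_iff] at hj
      subst hj
      rw [hi]
  · intro k l
    refine ⟨(s.1 k + l, s.2 l + k), by simp [spermOfShifts_eq_one_iff], ?_⟩
    rintro ⟨i, j⟩ h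
    exact Prod.ext_iff.2 ((spermOfShifts_eq_one_iff s k i l j).1 h)

theorem IsSPerm.exists_spermOfShifts_eq {A : (Fin 2 × Fin 2) → (Fin 2 × Fin 2) → Fin 2}
    (hA : IsSPerm 2 A) : ∃ s, spermOfShifts s = A := by
  obtain ⟨hrow, hcol, hblock⟩ := hA
  choose p hp hp_unique using hblock
  beta_reduce at hp hp_unique
  have hfst (k : Fin 2) : (p k 1).1 = (p k 0).1 + 1 := by
    refine fin_two_eq_add_one_of_ne fun h => ?_
    have h₁ := hp k 1
    rw [← h] at h₁
    simpa using congrArg Prod.fst ((hrow _).unique (hp k 0) h₁)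
  have hsnd (l : Fin 2) : (p 1 l).2 = (p 0 l).2 + 1 := by
    refine fin_two_eq_add_one_of_ne fun h => ?_
    have h₁ := hp 1 l
    rw [← h] at h₁
    simpa using congrArg Prod.fst ((hcol _).unique (hp 0 l) h₁)
  have hpos (k l : Fin 2) : p k l = ((p k 0).1 + l, (p 0 l).2 + k) := by
    refine Prod.ext ?_ ?_
    · revert l; simp [Fin.forall_fin_two, hfst]
    · revert k; simp [Fin.forall_fin_two, hsnd]
  refine ⟨(fun k => (p k 0).1, fun l => (p 0 l).2), ?_⟩
  funext ⟨k, i⟩ ⟨l, j⟩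
  refine fin_two_eq_of_eq_one_iff ?_
  rw [spermOfShifts_eq_one_iff, ← Prod.mk_inj, ← hpos]
  exact ⟨fun h => by simpa [← h] using hp k l, fun h => hp_unique k l (i, j) h⟩

theorem spermOfShifts_injective : Function.Injective spermOfShifts := by
  intro s t h
  have key (k l : Fin 2) : s.1 k + l = t.1 k + l ∧ s.2 l + k = t.2 l + k := by
    rw [← spermOfShifts_eq_one_iff, ← h, spermOfShifts_eq_one_iff]
    exact ⟨rfl, rfl⟩
  exact Prod.ext (funext fun k => add_right_cancel (key k 0).1)
    (funext fun l => add_right_cancel (key 0 l).2)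

theorem disjointS_spermOfShifts_iff (s t : (Fin 2 → Fin 2) × (Fin 2 → Fin 2)) :
    DisjointS 2 (spermOfShifts s) (spermOfShifts t) ↔
      ∀ k l, ¬ (s.1 k = t.1 k ∧ s.2 l = t.2 l) := by
  refine ⟨fun h k l hkl => h ⟨(k, s.1 k + l), (l, s.2 l + k), ?_⟩, ?_⟩
  · simp [spermOfShifts_eq_one_iff, hkl]
  · rintro h ⟨⟨k, i⟩, ⟨l, j⟩, hs, ht⟩
    rw [spermOfShifts_eq_one_iff] at hs ht
    exact h k l ⟨add_right_cancel (hs.1.symm.trans ht.1), add_right_cancel (hs.2.symm.trans ht.2)⟩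

set_option maxRecDepth 100000 in
theorem card_disjoint_shifts (s : (Fin 2 → Fin 2) × (Fin 2 → Fin 2)) :
    Fintype.card {t : (Fin 2 → Fin 2) × (Fin 2 → Fin 2) //
      ∀ k l, ¬ (s.1 k = t.1 k ∧ s.2 l = t.2 l)} = 7 := by
  revert s; decide

/-- For every `4 × 4` S-permutation matrix `A`, exactly `7` S-permutation
matrices are disjoint from `A`. -/
theorem card_disjoint_sperm_two
    (A : (Fin 2 × Fin 2) → (Fin 2 × Fin 2) → Fin 2) (hA : IsSPerm 2 A) :
    Nat.card {B : (Fin 2 × Fin 2) → (Fin 2 × Fin 2) → Fin 2 //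
        IsSPerm 2 B ∧ DisjointS 2 A B} = 7 := by
  obtain ⟨s, rfl⟩ := hA.exists_spermOfShifts_eq
  rw [← card_disjoint_shifts s, ← Nat.card_eq_fintype_card]
  symm
  refine Nat.card_congr (Equiv.ofBijective
    (fun t => ⟨spermOfShifts t.1, isSPerm_spermOfShifts t.1,
      (disjointS_spermOfShifts_iff s t.1).2 t.2⟩) ⟨fun t u h => ?_, ?_⟩)
  · exact Subtype.ext (spermOfShifts_injective (congrArg Subtype.val h))
  · rintro ⟨B, hB, hAB⟩
    obtain ⟨t, rfl⟩ := hB.exists_spermOfShifts_eq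
    exact ⟨⟨t, (disjointS_spermOfShifts_iff s t).1 hAB⟩, rfl⟩
end

section
/- For every 9×9 S-permutation matrix A (the case n = 3), the number of 9×9 S-permutation matrices B disjoint from A is exactly 17972. -/
/-- The matrix whose single `1` in block `(k, l)` is at row `a k l` and column `b l k` of it. -/
def ofPerms {n : ℕ} (a b : Fin n → Equiv.Perm (Fin n)) :
    (Fin n × Fin n) → (Fin n × Fin n) → Fin 2 :=
  fun r c => if a r.1 c.1 = r.2 ∧ b c.1 r.1 = c.2 then 1 else 0

theorem ofPerms_eq_one_iff {n : ℕ} (a b : Fin n → Equiv.Perm (Fin n)) (r c : Fin n × Fin n) :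
    ofPerms a b r c = 1 ↔ a r.1 c.1 = r.2 ∧ b c.1 r.1 = c.2 := by
  simp [ofPerms]

theorem isSPerm_ofPerms {n : ℕ} (a b : Fin n → Equiv.Perm (Fin n)) :
    IsSPerm n (ofPerms a b) := by
  simp only [IsSPerm, ofPerms_eq_one_iff]
  refine ⟨fun ⟨k, i⟩ => ⟨((a k).symm i, b ((a k).symm i) k), by simp, ?_⟩,
    fun ⟨l, j⟩ => ⟨((b l).symm j, a ((b l).symm j) l), by simp, ?_⟩,
    fun k l => ⟨(a k l, b l k), by simp, ?_⟩⟩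
  · rintro ⟨l, j⟩ ⟨h₁, h₂⟩
    dsimp only at h₁ h₂
    subst h₁ h₂
    simp
  · rintro ⟨k, i⟩ ⟨h₁, h₂⟩
    dsimp only at h₁ h₂
    subst h₁ h₂
    simp
  · rintro ⟨i, j⟩ ⟨h₁, h₂⟩
    exact Prod.ext h₁.symm h₂.symm

theorem IsSPerm.exists_eq_ofPerms {n : ℕ} {A : (Fin n × Fin n) → (Fin n × Fin n) → Fin 2}
    (hA : IsSPerm n A) : ∃ a b : Fin n → Equiv.Perm (Fin n), A = ofPerms a b := by
  obtain ⟨hrow, hcol, hblock⟩ := hA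
  choose p hp hp_unique using hblock
  have ha (k : Fin n) : Function.Injective fun l => (p k l).1 := by
    intro l l' h
    have h' : A (k, (p k l).1) (l', (p k l').2) = 1 := (show (p k l).1 = _ from h) ▸ hp k l'
    exact congrArg Prod.fst ((hrow (k, (p k l).1)).unique (hp k l) h')
  have hb (l : Fin n) : Function.Injective fun k => (p k l).2 := by
    intro k k' h
    have h' : A (k', (p k' l).1) (l, (p k l).2) = 1 := (show (p k l).2 = _ from h) ▸ hp k' l
    exact congrArg Prod.fst ((hcol (l, (p k l).2)).unique (hp k l) h')
  refine ⟨fun k => .ofBijective _ (Finite.injective_iff_bijective.mp (ha k)),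
    fun l => .ofBijective _ (Finite.injective_iff_bijective.mp (hb l)), ?_⟩
  funext ⟨k, i⟩ ⟨l, j⟩
  have hiff : A (k, i) (l, j) = 1 ↔ (p k l).1 = i ∧ (p k l).2 = j := by
    constructor
    · intro h
      have := hp_unique k l (i, j) h
      simp [← this]
    · rintro ⟨rfl, rfl⟩
      exact hp k l
  simp only [ofPerms, Equiv.ofBijective_apply, ← hiff]
  split_ifs <;> lia

theorem ofPerms_injective {n : ℕ} {a b a' b' : Fin n → Equiv.Perm (Fin n)}
    (h : ofPerms a b = ofPerms a' b') : a = a' ∧ b = b' := by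
  have key (k l : Fin n) : a' k l = a k l ∧ b' l k = b l k := by
    have h₁ : ofPerms a b (k, a k l) (l, b l k) = 1 := by simp [ofPerms]
    rwa [h, ofPerms_eq_one_iff] at h₁
  exact ⟨funext fun k => Equiv.ext fun l => (key k l).1.symm,
    funext fun l => Equiv.ext fun k => (key k l).2.symm⟩

theorem disjointS_ofPerms_mul_iff {n : ℕ} (a b σ τ : Fin n → Equiv.Perm (Fin n)) :
    DisjointS n (ofPerms a b) (ofPerms (a * σ) (b * τ)) ↔
      ∀ l k, σ k l = l → τ l k ≠ k := by
  simp only [DisjointS, ofPerms_eq_one_iff]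
  constructor
  · intro h l k hσ hτ
    exact h ⟨(k, a k l), (l, b l k), by simp [hσ, hτ]⟩
  · rintro h ⟨⟨k, i⟩, ⟨l, j⟩, ⟨h₁, h₂⟩, h₃, h₄⟩
    dsimp only [Pi.mul_apply, Equiv.Perm.mul_apply] at h₁ h₂ h₃ h₄
    exact h l k ((a k).injective (h₃.trans h₁.symm)) ((b l).injective (h₄.trans h₂.symm))

/-- The number of S-permutation matrices disjoint from a given one, as a sum over the relative row
permutations `σ`; for given `σ` the relative column permutations can be chosen independently. -/
theorem card_disjoint_sperm_s12 {n : ℕ} {A : (Fin n × Fin n) → (Fin n × Fin n) → Fin 2}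
    (hA : IsSPerm n A) :
    Nat.card {B : (Fin n × Fin n) → (Fin n × Fin n) → Fin 2 // IsSPerm n B ∧ DisjointS n A B} =
      ∑ σ : Fin n → Equiv.Perm (Fin n), ∏ l,
        Fintype.card {τ : Equiv.Perm (Fin n) // ∀ k, σ k l = l → τ k ≠ k} := by
  obtain ⟨a, b, rfl⟩ := hA.exists_eq_ofPerms
  let f : (Σ σ : Fin n → Equiv.Perm (Fin n),
      ∀ l, {τ : Equiv.Perm (Fin n) // ∀ k, σ k l = l → τ k ≠ k}) →
      {B // IsSPerm n B ∧ DisjointS n (ofPerms a b) B} := fun q =>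
    ⟨ofPerms (a * q.1) (b * fun l => (q.2 l).1), isSPerm_ofPerms _ _,
      (disjointS_ofPerms_mul_iff _ _ _ _).2 fun l => (q.2 l).2⟩
  have hf : Function.Bijective f := by
    constructor
    · rintro ⟨σ, τ⟩ ⟨σ', τ'⟩ h
      obtain ⟨h₁, h₂⟩ := ofPerms_injective (Subtype.ext_iff.mp h)
      obtain rfl : σ = σ' := mul_left_cancel h₁
      have h₃ := mul_left_cancel h₂
      congr 1
      funext l
      exact Subtype.ext (congrFun h₃ l)
    · rintro ⟨B, hB, hdisj⟩
      obtain ⟨a', b', rfl⟩ := hB.exists_eq_ofPerms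
      have ha : a' = a * (a⁻¹ * a') := by simp
      have hb : b' = b * (b⁻¹ * b') := by simp
      rw [ha, hb, disjointS_ofPerms_mul_iff] at hdisj
      exact ⟨⟨a⁻¹ * a', fun l => ⟨(b⁻¹ * b') l, hdisj l⟩⟩,
        Subtype.ext (congrArg₂ ofPerms ha.symm hb.symm)⟩
  rw [← Nat.card_congr (Equiv.ofBijective f hf), Nat.card_eq_fintype_card, Fintype.card_sigma]
  simp only [Fintype.card_pi]

/-- For every `9 × 9` S-permutation matrix `A`, exactly `17972` S-permutation
matrices are disjoint from `A`. -/
theorem card_disjoint_sperm_three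
    (A : (Fin 3 × Fin 3) → (Fin 3 × Fin 3) → Fin 2) (hA : IsSPerm 3 A) :
    Nat.card {B : (Fin 3 × Fin 3) → (Fin 3 × Fin 3) → Fin 2 //
        IsSPerm 3 B ∧ DisjointS 3 A B} = 17972 := by
  rw [card_disjoint_sperm_s12 hA]
  decide +kernel
end

section
/- The number of unordered pairs {A, B} of distinct disjoint 9×9 S-permutation matrices (the case n = 3) is exactly 419250816. -/
/-- Parameters of an S-permutation matrix: in the block `(k, l)` the entry `1` is at row `x.1 k l` and
column `x.2 l k`. -/
abbrev SPermParam (n : ℕ) : Type :=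
  (Fin n → Equiv.Perm (Fin n)) × (Fin n → Equiv.Perm (Fin n))

namespace SPermParam

variable {n : ℕ}

/-- The S-permutation matrix with given parameters. -/
def toMatrix (x : SPermParam n) (r c : Fin n × Fin n) : Fin 2 :=
  if r.2 = x.1 r.1 c.1 ∧ c.2 = x.2 c.1 r.1 then 1 else 0

theorem toMatrix_eq_one_iff (x : SPermParam n) (r c : Fin n × Fin n) :
    x.toMatrix r c = 1 ↔ r.2 = x.1 r.1 c.1 ∧ c.2 = x.2 c.1 r.1 := by
  simp [toMatrix]

theorem toMatrix_injective : Function.Injective (toMatrix (n := n)) := by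
  intro x y h
  have key (k l : Fin n) : x.1 k l = y.1 k l ∧ x.2 l k = y.2 l k := by
    rw [← toMatrix_eq_one_iff y (k, x.1 k l) (l, x.2 l k), ← h, toMatrix_eq_one_iff]
    exact ⟨rfl, rfl⟩
  ext1 <;> ext1 k <;> ext1 l
  · exact (key k l).1
  · exact (key l k).2

theorem isSPerm_toMatrix (x : SPermParam n) : IsSPerm n x.toMatrix := by
  simp only [IsSPerm, toMatrix_eq_one_iff]
  refine ⟨fun ⟨k, i⟩ => ⟨((x.1 k).symm i, x.2 ((x.1 k).symm i) k), by simp, ?_⟩,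
    fun ⟨l, j⟩ => ⟨((x.2 l).symm j, x.1 ((x.2 l).symm j) l), by simp, ?_⟩,
    fun k l => ⟨(x.1 k l, x.2 l k), by simp, fun p hp => Prod.ext hp.1 hp.2⟩⟩
  · rintro ⟨l, j⟩ ⟨hi, hj⟩
    simp_all
  · rintro ⟨k, i⟩ ⟨hi, hj⟩
    simp_all

theorem exists_toMatrix_eq {A : (Fin n × Fin n) → (Fin n × Fin n) → Fin 2} (hA : IsSPerm n A) :
    ∃ x : SPermParam n, x.toMatrix = A := by
  obtain ⟨hrow, hcol, hblock⟩ := hA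
  choose p hp hp_unique using hblock
  have hrow_inj (k : Fin n) : Function.Injective fun l => (p k l).1 := by
    intro l m h
    have hm := hp k m
    simp only at h hm
    rw [← h] at hm
    exact congrArg Prod.fst ((hrow _).unique (hp k l) hm)
  have hcol_inj (l : Fin n) : Function.Injective fun k => (p k l).2 := by
    intro k m h
    have hm := hp m l
    simp only at h hm
    rw [← h] at hm
    exact congrArg Prod.fst ((hcol _).unique (hp k l) hm)
  refine ⟨(fun k => .ofBijective _ (Finite.injective_iff_bijective.1 (hrow_inj k)),
    fun l => .ofBijective _ (Finite.injective_iff_bijective.1 (hcol_inj l))), ?_⟩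
  funext ⟨k, i⟩ ⟨l, j⟩
  have h : i = (p k l).1 ∧ j = (p k l).2 ↔ A (k, i) (l, j) = 1 :=
    ⟨fun ⟨hi, hj⟩ => hi ▸ hj ▸ hp k l, fun h => Prod.ext_iff.1 (hp_unique k l (i, j) h)⟩
  simp only [toMatrix, Equiv.ofBijective_apply, h]
  split_ifs with h1
  · exact h1.symm
  · lia

/-- The graph on the parameters joining those whose S-permutation matrices are disjoint. -/
def disjointnessGraph (n : ℕ) [NeZero n] : SimpleGraph (SPermParam n) where
  Adj x y := ∀ k l, ¬ (y.1 k l = x.1 k l ∧ y.2 l k = x.2 l k)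
  symm := ⟨fun _ _ h k l e => h k l ⟨e.1.symm, e.2.symm⟩⟩
  loopless := ⟨fun _ h => h 0 0 ⟨rfl, rfl⟩⟩

instance [NeZero n] : DecidableRel (disjointnessGraph n).Adj := fun x y =>
  inferInstanceAs (Decidable (∀ k l, ¬ (y.1 k l = x.1 k l ∧ y.2 l k = x.2 l k)))

theorem disjointS_toMatrix_iff [NeZero n] (x y : SPermParam n) :
    DisjointS n x.toMatrix y.toMatrix ↔ (disjointnessGraph n).Adj x y := by
  simp only [DisjointS, toMatrix_eq_one_iff, disjointnessGraph]
  constructor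
  · intro h k l e
    exact h ⟨(k, x.1 k l), (l, x.2 l k), ⟨rfl, rfl⟩, e.1.symm, e.2.symm⟩
  · rintro h ⟨⟨k, i⟩, ⟨l, j⟩, ⟨h1, h2⟩, h3, h4⟩
    exact h k l ⟨h3.symm.trans h1, h4.symm.trans h2⟩

theorem card_disjoint_pairs_eq_card_edgeSet (n : ℕ) [NeZero n] :
    Nat.card {s : Set ((Fin n × Fin n) → (Fin n × Fin n) → Fin 2) //
      ∃ A B, IsSPerm n A ∧ IsSPerm n B ∧ A ≠ B ∧ DisjointS n A B ∧ s = {A, B}} =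
      Nat.card (disjointnessGraph n).edgeSet := by
  symm
  have himage (x y : SPermParam n) :
      toMatrix '' {z | z ∈ s(x, y)} = {x.toMatrix, y.toMatrix} := by
    rw [← Set.image_pair]
    congr 1
    ext z
    simp
  refine Nat.card_eq_of_bijective
    (fun e => ⟨toMatrix '' {z | z ∈ e.1}, ?_⟩) ⟨?_, ?_⟩
  · obtain ⟨⟨x, y⟩, he⟩ := e
    have hxy : (disjointnessGraph n).Adj x y := he
    exact ⟨_, _, x.isSPerm_toMatrix, y.isSPerm_toMatrix, toMatrix_injective.ne hxy.ne,
      (disjointS_toMatrix_iff x y).2 hxy, himage x y⟩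
  · intro e f h
    have h_set := toMatrix_injective.image_injective (Subtype.ext_iff.1 h)
    exact Subtype.ext (Sym2.ext fun z => Set.ext_iff.1 h_set z)
  · rintro ⟨_, A, B, hA, hB, -, hAB, rfl⟩
    obtain ⟨x, rfl⟩ := exists_toMatrix_eq hA
    obtain ⟨y, rfl⟩ := exists_toMatrix_eq hB
    exact ⟨⟨s(x, y), (disjointS_toMatrix_iff x y).1 hAB⟩, Subtype.ext (himage x y)⟩

theorem disjointnessGraph_adj_iff_one_inv_mul [NeZero n] (x y : SPermParam n) :
    (disjointnessGraph n).Adj x y ↔ (disjointnessGraph n).Adj 1 (x⁻¹ * y) := by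
  simp [disjointnessGraph, Equiv.symm_apply_eq]

theorem degree_disjointnessGraph [NeZero n] (x : SPermParam n) :
    (disjointnessGraph n).degree x = ∑ σ : Fin n → Equiv.Perm (Fin n), ∏ l : Fin n,
      Fintype.card {t : Equiv.Perm (Fin n) // ∀ k, ¬ (σ k l = l ∧ t k = k)} := by
  rw [← SimpleGraph.card_neighborSet_eq_degree]
  have e : (disjointnessGraph n).neighborSet x ≃
      Σ σ : Fin n → Equiv.Perm (Fin n), ∀ l : Fin n,
        {t : Equiv.Perm (Fin n) // ∀ k, ¬ (σ k l = l ∧ t k = k)} :=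
    ((Equiv.mulLeft x⁻¹).subtypeEquiv (q := fun y => (disjointnessGraph n).Adj 1 y)
      (disjointnessGraph_adj_iff_one_inv_mul x)).trans
    { toFun := fun y => ⟨y.1.1, fun l => ⟨y.1.2 l, fun k => y.2 k l⟩⟩
      invFun := fun z => ⟨(z.1, fun l => (z.2 l).1), fun k l => (z.2 l).2 k⟩
      left_inv := fun _ => rfl
      right_inv := fun _ => rfl }
  rw [Fintype.card_congr e, Fintype.card_sigma]
  simp only [Fintype.card_pi]

theorem degree_disjointnessGraph_three (x : SPermParam 3) :
    (disjointnessGraph 3).degree x = 17972 := by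
  rw [degree_disjointnessGraph]
  decide +kernel

theorem card_edgeSet_disjointnessGraph_three :
    Nat.card (disjointnessGraph 3).edgeSet = 419250816 := by
  have h := (disjointnessGraph 3).sum_degrees_eq_twice_card_edges
  simp only [degree_disjointnessGraph_three, Finset.sum_const, Finset.card_univ, smul_eq_mul,
    Fintype.card_prod, Fintype.card_pi, Finset.prod_const, Fintype.card_perm,
    Fintype.card_fin] at h
  rw [Nat.card_eq_fintype_card, ← SimpleGraph.edgeFinset_card]
  generalize (disjointnessGraph 3).edgeFinset.card = m at h ⊢
  norm_num [Nat.factorial] at h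
  lia

end SPermParam

/-- The number of unordered pairs of distinct disjoint `9 × 9` S-permutation
matrices is `419250816`. -/
theorem card_disjoint_pairs_three :
    Nat.card {s : Set ((Fin 3 × Fin 3) → (Fin 3 × Fin 3) → Fin 2) //
        ∃ A B, IsSPerm 3 A ∧ IsSPerm 3 B ∧ A ≠ B ∧ DisjointS 3 A B ∧ s = {A, B}} = 419250816 := by
  rw [SPermParam.card_disjoint_pairs_eq_card_edgeSet,
    SPermParam.card_edgeSet_disjointnessGraph_three]
end

section
/- The probability that two distinct uniformly random 9×9 S-permutation matrices are disjoint is 17972/46655; that is, the number of unordered disjoint pairs of 9×9 S-permutation matrices divided by the total number of unordered pairs of distinct 9×9 S-permutation matrices equals, as a rational number, 17972/46655 (= 17972/((3!)^6 − 1)). -/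
/-- Parameters of S-permutation matrices: in the block `(k, l)`, the entry `1` sits in the row
`x.1 k l` and the column `x.2 l k`. -/
abbrev SParam (n : ℕ) : Type :=
  (Fin n → Equiv.Perm (Fin n)) × (Fin n → Equiv.Perm (Fin n))

namespace SParam

variable {n : ℕ}

/-- The S-permutation matrix with given parameters. -/
def toMatrix (x : SParam n) : (Fin n × Fin n) → (Fin n × Fin n) → Fin 2 :=
  fun r c => if x.1 r.1 c.1 = r.2 ∧ x.2 c.1 r.1 = c.2 then 1 else 0

theorem toMatrix_eq_one_iff (x : SParam n) (r c : Fin n × Fin n) :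
    x.toMatrix r c = 1 ↔ x.1 r.1 c.1 = r.2 ∧ x.2 c.1 r.1 = c.2 := by
  simp [toMatrix]

theorem isSPerm_toMatrix (x : SParam n) : IsSPerm n x.toMatrix := by
  simp only [IsSPerm, toMatrix_eq_one_iff]
  refine ⟨fun ⟨k, i⟩ => ?_, fun ⟨l, j⟩ => ?_, fun k l => ?_⟩
  · refine ⟨((x.1 k).symm i, x.2 ((x.1 k).symm i) k), by simp, ?_⟩
    rintro ⟨l, j⟩ ⟨h, h'⟩
    dsimp only at h h'
    subst h h'
    simp
  · refine ⟨((x.2 l).symm j, x.1 ((x.2 l).symm j) l), by simp, ?_⟩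
    rintro ⟨k, i⟩ ⟨h, h'⟩
    dsimp only at h h'
    subst h h'
    simp
  · refine ⟨(x.1 k l, x.2 l k), by simp, ?_⟩
    rintro ⟨i, j⟩ ⟨h, h'⟩
    exact Prod.ext h.symm h'.symm

theorem toMatrix_injective : Function.Injective (toMatrix (n := n)) := by
  intro x y h
  have key (k l : Fin n) : y.1 k l = x.1 k l ∧ y.2 l k = x.2 l k := by
    rw [← toMatrix_eq_one_iff y (k, x.1 k l) (l, x.2 l k), ← h, toMatrix_eq_one_iff]
    exact ⟨rfl, rfl⟩
  refine Prod.ext ?_ ?_ <;> funext k <;> ext l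
  · rw [(key k l).1]
  · rw [(key l k).2]

theorem exists_toMatrix_eq {A : (Fin n × Fin n) → (Fin n × Fin n) → Fin 2} (hA : IsSPerm n A) :
    ∃ x : SParam n, x.toMatrix = A := by
  obtain ⟨hrow, hcol, hblock⟩ := hA
  choose p hp hunique using hblock
  have hσ (k : Fin n) : Function.Injective fun l => (p k l).1 := fun l l' h =>
    congrArg Prod.fst ((hrow (k, (p k l).1)).unique (hp k l)
      (by simp only at h; rw [h]; exact hp k l'))
  have hτ (l : Fin n) : Function.Injective fun k => (p k l).2 := fun k k' h =>
    congrArg Prod.fst ((hcol (l, (p k l).2)).unique (hp k l)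
      (by simp only at h; rw [h]; exact hp k' l))
  refine ⟨(fun k => .ofBijective _ (Finite.injective_iff_bijective.1 (hσ k)),
    fun l => .ofBijective _ (Finite.injective_iff_bijective.1 (hτ l))), ?_⟩
  funext ⟨k, i⟩ ⟨l, j⟩
  have h : A (k, i) (l, j) = 1 ↔ (p k l).1 = i ∧ (p k l).2 = j := by
    constructor
    · intro h
      have := hunique k l (i, j) h
      simp [← this]
    · rintro ⟨rfl, rfl⟩
      exact hp k l
  have fin_two_ext {a b : Fin 2} (hab : a = 1 ↔ b = 1) : a = b := by lia
  refine fin_two_ext ?_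
  rw [h, toMatrix_eq_one_iff]
  rfl

theorem isSPerm_iff_exists {A : (Fin n × Fin n) → (Fin n × Fin n) → Fin 2} :
    IsSPerm n A ↔ ∃ x : SParam n, x.toMatrix = A :=
  ⟨exists_toMatrix_eq, fun ⟨x, hx⟩ => hx ▸ x.isSPerm_toMatrix⟩

theorem disjointS_toMatrix_iff (x y : SParam n) :
    DisjointS n x.toMatrix y.toMatrix ↔ ∀ k l, ¬(x.1 k l = y.1 k l ∧ x.2 l k = y.2 l k) := by
  simp only [DisjointS, toMatrix_eq_one_iff]
  constructor
  · rintro h k l ⟨h₁, h₂⟩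
    exact h ⟨(k, x.1 k l), (l, x.2 l k), ⟨rfl, rfl⟩, h₁.symm, h₂.symm⟩
  · rintro h ⟨⟨k, i⟩, ⟨l, j⟩, ⟨h₁, h₂⟩, h₃, h₄⟩
    exact h k l ⟨h₁.trans h₃.symm, h₂.trans h₄.symm⟩

/-- The graph on S-permutation matrices whose edges are the disjoint pairs. -/
def disjointGraph (n : ℕ) [NeZero n] : SimpleGraph (SParam n) where
  Adj x y := ∀ k l, ¬(x.1 k l = y.1 k l ∧ x.2 l k = y.2 l k)
  symm := ⟨fun _ _ h k l hkl => h k l ⟨hkl.1.symm, hkl.2.symm⟩⟩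
  loopless := ⟨fun _ h => h 0 0 ⟨rfl, rfl⟩⟩

instance [NeZero n] : DecidableRel (disjointGraph n).Adj := fun x y =>
  inferInstanceAs (Decidable (∀ k l, ¬(x.1 k l = y.1 k l ∧ x.2 l k = y.2 l k)))

theorem disjointGraph_adj_iff_one_adj [NeZero n] (x y : SParam n) :
    (disjointGraph n).Adj x y ↔ (disjointGraph n).Adj 1 (x⁻¹ * y) := by
  simp only [disjointGraph, Prod.fst_one, Prod.snd_one, Pi.one_apply, Equiv.Perm.one_apply,
    Prod.fst_mul, Prod.snd_mul, Pi.mul_apply, Prod.fst_inv, Prod.snd_inv, Pi.inv_apply,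
    Equiv.Perm.mul_apply, Equiv.Perm.eq_inv_iff_eq]

theorem degree_disjointGraph [NeZero n] (x : SParam n) :
    (disjointGraph n).degree x = (disjointGraph n).degree 1 := by
  refine Finset.card_equiv (Equiv.mulLeft x⁻¹) fun y => ?_
  rw [SimpleGraph.mem_neighborFinset, SimpleGraph.mem_neighborFinset,
    disjointGraph_adj_iff_one_adj, Equiv.coe_mulLeft]

/-- Once the rows are fixed, the columns can be chosen independently in each column of blocks. -/
theorem degree_disjointGraph_one [NeZero n] :
    (disjointGraph n).degree 1 = ∑ σ : Fin n → Equiv.Perm (Fin n), ∏ l,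
      (Finset.univ.filter fun τ : Equiv.Perm (Fin n) => ∀ k, ¬(l = σ k l ∧ k = τ k)).card := by
  simp_rw [← Fintype.card_piFinset]
  rw [← Finset.card_sigma]
  refine Finset.card_equiv (Equiv.sigmaEquivProd _ _).symm fun y => ?_
  rw [SimpleGraph.mem_neighborFinset]
  simp only [disjointGraph, Finset.mem_sigma, Finset.mem_univ,
    Fintype.mem_piFinset, Finset.mem_filter, true_and]
  exact forall_comm

theorem degree_disjointGraph_three_one : (disjointGraph 3).degree 1 = 17972 := by
  rw [degree_disjointGraph_one]
  decide +kernel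

theorem card_three : Fintype.card (SParam 3) = 46656 := by
  simp [Fintype.card_perm, Nat.factorial]

end SParam

/-- The handshake lemma for a regular graph, with edges seen as two-element sets of labels. -/
theorem SimpleGraph.IsRegularOfDegree.card_edge_image_mul_two {V α : Type*} [Fintype V]
    {G : SimpleGraph V} [DecidableRel G.Adj] {d : ℕ} (hG : G.IsRegularOfDegree d) {f : V → α}
    (hf : Function.Injective f) :
    Nat.card {s : Set α // ∃ x y, G.Adj x y ∧ s = {f x, f y}} * 2 = Fintype.card V * d := by
  classical
  have hinj : Function.Injective fun e : Sym2 V => f '' (e : Set V) :=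
    hf.image_injective.comp SetLike.coe_injective
  have himage : {s : Set α | ∃ x y, G.Adj x y ∧ s = {f x, f y}} =
      (fun e : Sym2 V => f '' (e : Set V)) '' G.edgeSet := by
    ext s
    simp only [Set.mem_ofPred_eq, Set.mem_image, Sym2.exists, SimpleGraph.mem_edgeSet,
      Sym2.coe_mk, Set.image_pair, eq_comm]
  have hcard : Nat.card {s : Set α // ∃ x y, G.Adj x y ∧ s = {f x, f y}} = G.edgeFinset.card := by
    change Nat.card {s : Set α | ∃ x y, G.Adj x y ∧ s = {f x, f y}} = _
    rw [himage, Nat.card_image_of_injective hinj, Nat.card_eq_fintype_card,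
      SimpleGraph.edgeFinset_card]
  rw [hcard, mul_comm, ← G.sum_degrees_eq_twice_card_edges]
  simp [hG.degree_eq]

/-- The number of unordered disjoint pairs of `9 × 9` S-permutation matrices
divided by the total number of unordered pairs of distinct `9 × 9`
S-permutation matrices equals `17972/46655`. -/
theorem probability_disjoint_three :
    (Nat.card {s : Set ((Fin 3 × Fin 3) → (Fin 3 × Fin 3) → Fin 2) //
        ∃ A B, IsSPerm 3 A ∧ IsSPerm 3 B ∧ A ≠ B ∧ DisjointS 3 A B ∧ s = {A, B}} : ℚ) /
      (Nat.card {s : Set ((Fin 3 × Fin 3) → (Fin 3 × Fin 3) → Fin 2) //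
        ∃ A B, IsSPerm 3 A ∧ IsSPerm 3 B ∧ A ≠ B ∧ s = {A, B}} : ℚ) = 17972 / 46655 := by
  have hdisjoint : (SParam.disjointGraph 3).IsRegularOfDegree 17972 := fun x =>
    (SParam.degree_disjointGraph x).trans SParam.degree_disjointGraph_three_one
  have htop := SimpleGraph.IsRegularOfDegree.top (V := SParam 3)
  have h₁ := hdisjoint.card_edge_image_mul_two SParam.toMatrix_injective
  have h₂ := htop.card_edge_image_mul_two SParam.toMatrix_injective
  have e₁ (s : Set ((Fin 3 × Fin 3) → (Fin 3 × Fin 3) → Fin 2)) :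
      (∃ A B, IsSPerm 3 A ∧ IsSPerm 3 B ∧ A ≠ B ∧ DisjointS 3 A B ∧ s = {A, B}) ↔
        ∃ x y, (SParam.disjointGraph 3).Adj x y ∧ s = {x.toMatrix, y.toMatrix} := by
    simp only [SParam.isSPerm_iff_exists]
    constructor
    · rintro ⟨_, _, ⟨x, rfl⟩, ⟨y, rfl⟩, -, h, rfl⟩
      exact ⟨x, y, (SParam.disjointS_toMatrix_iff x y).1 h, rfl⟩
    · rintro ⟨x, y, h, rfl⟩
      exact ⟨_, _, ⟨x, rfl⟩, ⟨y, rfl⟩, SParam.toMatrix_injective.ne h.ne,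
        (SParam.disjointS_toMatrix_iff x y).2 h, rfl⟩
  have e₂ (s : Set ((Fin 3 × Fin 3) → (Fin 3 × Fin 3) → Fin 2)) :
      (∃ A B, IsSPerm 3 A ∧ IsSPerm 3 B ∧ A ≠ B ∧ s = {A, B}) ↔
        ∃ x y, (⊤ : SimpleGraph (SParam 3)).Adj x y ∧ s = {x.toMatrix, y.toMatrix} := by
    simp only [SParam.isSPerm_iff_exists, SimpleGraph.top_adj]
    constructor
    · rintro ⟨_, _, ⟨x, rfl⟩, ⟨y, rfl⟩, h, rfl⟩
      exact ⟨x, y, fun hxy => h (congrArg _ hxy), rfl⟩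
    · rintro ⟨x, y, h, rfl⟩
      exact ⟨_, _, ⟨x, rfl⟩, ⟨y, rfl⟩, SParam.toMatrix_injective.ne h, rfl⟩
  rw [Nat.card_congr (Equiv.subtypeEquivRight e₁), Nat.card_congr (Equiv.subtypeEquivRight e₂)]
  rw [SParam.card_three] at h₁ h₂
  rw [Nat.eq_of_mul_eq_mul_right two_pos (h₁.trans (by norm_num : _ = 419250816 * 2)),
    Nat.eq_of_mul_eq_mul_right two_pos (h₂.trans (by norm_num : 46656 * (46656 - 1) = 1088367840 * 2))]
  norm_num
end
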